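/- (Exchange Lemma II) Let d ≥ 2 and n = d+1. For any symmetrical code that satisfies node regeneration, and for any ℓ ∈ [1:d−1] and ℓ₁ ∈ [0:⌊ℓ/2⌋], one has ((d−ℓ₁)/(d−ℓ)) · H(U^{(ℓ₁,ℓ)}) + H(U^{(ℓ₁,ℓ₁+1)}, S_{ℓ₁+1→[1:ℓ₁]}) ≥ ((d−ℓ₁)/(d−ℓ)) · H(U^{(ℓ₁,ℓ+1)}) + H(U^{(ℓ₁,ℓ₁)}, S_{ℓ₁+1→[1:ℓ₁]}). -/

import Mathlib

open scoped BigOperators Classical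

namespace MDCSR

noncomputable section

/-- `X` is a deterministic function of `Y`. -/
def IsFuncOf {Ω α β : Type*} (X : Ω → α) (Y : Ω → β) : Prop :=
  ∃ f : β → α, ∀ ω, X ω = f (Y ω)

variable {Ω V : Type} [Fintype Ω]

/-- Probability of the event `X = x` under the probability mass function `p`. -/
def pm (p : Ω → ℝ) {α : Type*} (X : Ω → α) (x : α) : ℝ :=
  ∑ ω ∈ Finset.univ.filter (fun ω' => X ω' = x), p ω

/-- Shannon entropy of the random variable `X` under the probability mass function `p`. -/
def H (p : Ω → ℝ) {α : Type*} (X : Ω → α) : ℝ :=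
  -∑ ω, p ω * Real.log (pm p X (X ω))

/-- An `(n = d+1, d)` code: messages `M 1, …, M d`, a key `K`, node contents
`W 1, …, W (d+1)`, and repair data `S i j` (data downloaded from node `i` to repair
node `j`), all random variables on a common finite probability space `(Ω, p)`.
The messages are mutually independent, the key is independent of the messages,
each `W i` is a deterministic function of the messages and the key, and each
`S i j` is a deterministic function of `W i`. -/
structure Code (Ω V : Type) [Fintype Ω] (d : ℕ) : Type where
  p : Ω → ℝ
  p_nonneg : ∀ ω, 0 ≤ p ω
  p_sum : ∑ ω, p ω = 1
  M : ℕ → Ω → V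
  K : Ω → V
  W : ℕ → Ω → V
  S : ℕ → ℕ → Ω → V
  M_indep : ∀ x : ℕ → V,
    pm p (fun ω (i : Fin d) => M (↑i + 1) ω) (fun i => x (↑i + 1)) =
      ∏ i ∈ Finset.Icc 1 d, pm p (M i) (x i)
  K_indep : ∀ (k : V) (x : ℕ → V),
    pm p (fun ω => (K ω, fun (i : Fin d) => M (↑i + 1) ω)) (k, fun i => x (↑i + 1)) =
      pm p K k * pm p (fun ω (i : Fin d) => M (↑i + 1) ω) (fun i => x (↑i + 1))
  W_func : ∀ i ∈ Finset.Icc 1 (d + 1),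
    IsFuncOf (W i) (fun ω => ((fun (j : Fin d) => M (↑j + 1) ω), K ω))
  S_func : ∀ i ∈ Finset.Icc 1 (d + 1), ∀ j ∈ Finset.Icc 1 (d + 1), i ≠ j →
    IsFuncOf (S i j) (W i)

/-- Descriptors for the basic random variables of a code. -/
inductive Atom where
  | M : ℕ → Atom
  | K : Atom
  | W : ℕ → Atom
  | S : ℕ → ℕ → Atom

variable {d : ℕ}

/-- The random variable described by an atom. -/
def Code.atomRV (C : Code Ω V d) : Atom → Ω → V
  | .M i => C.M i
  | .K => C.K
  | .W i => C.W i
  | .S i j => C.S i j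

/-- The joint random variable (tuple) described by a list of atoms. -/
def Code.rv (C : Code Ω V d) (L : List Atom) : Ω → List V :=
  fun ω => L.map fun a => C.atomRV a ω

/-- Joint entropy of a tuple of basic random variables. -/
def Code.HL (C : Code Ω V d) (L : List Atom) : ℝ := H C.p (C.rv L)

/-- Conditional entropy `H(L₁ | L₂)`. -/
def Code.CH (C : Code Ω V d) (L₁ L₂ : List Atom) : ℝ := C.HL (L₁ ++ L₂) - C.HL L₂

/-- Mutual information `I(L₁ ; L₂)`. -/
def Code.MI (C : Code Ω V d) (L₁ L₂ : List Atom) : ℝ :=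
  C.HL L₁ + C.HL L₂ - C.HL (L₁ ++ L₂)

/-- Relabeling of an atom along a permutation of the storage-node indices. -/
def Atom.perm (π : Equiv.Perm ℕ) : Atom → Atom
  | .M i => .M i
  | .K => .K
  | .W i => .W (π i)
  | .S i j => .S (π i) (π j)

/-- A code is symmetrical if every joint entropy of a tuple of the basic random
variables is invariant under every permutation of the storage-node indices `[1:n]`. -/
def Code.Symmetrical (C : Code Ω V d) : Prop :=
  ∀ π : Equiv.Perm ℕ, (∀ i ∈ Finset.Icc 1 (d + 1), π i ∈ Finset.Icc 1 (d + 1)) →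
    ∀ L : List Atom, C.HL (L.map (Atom.perm π)) = C.HL L

/-- The list `[a, a+1, …, b]`. -/
def icc (a b : ℕ) : List ℕ := List.range' a (b + 1 - a)

/-- `W_A` as a list of atoms. -/
def Ws (A : List ℕ) : List Atom := A.map Atom.W

/-- `M_A` as a list of atoms. -/
def MsL (A : List ℕ) : List Atom := A.map Atom.M

/-- `M^{(m)} = (M_1, …, M_m)`. -/
def Mup (m : ℕ) : List Atom := MsL (icc 1 m)

/-- `S_{B → j}`. -/
def Sto (B : List ℕ) (j : ℕ) : List Atom := B.map fun i => Atom.S i j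

/-- `S_{i → B}`. -/
def Sfrom (i : ℕ) (B : List ℕ) : List Atom := B.map fun j => Atom.S i j

/-- `S̄_{→ j} = S_{[j+1:n] → j}` (here `n = d+1`). -/
def SbarTo (d j : ℕ) : List Atom := Sto (icc (j + 1) (d + 1)) j

/-- `S̄_{→ A}`. -/
def SbarToL (d : ℕ) (A : List ℕ) : List Atom := (A.map (SbarTo d)).flatten

/-- `S̲_{→ j} = S_{[1:j-1] → j}`. -/
def SunderTo (j : ℕ) : List Atom := Sto (icc 1 (j - 1)) j

/-- `S̲_{→ A}`. -/
def SunderToL (A : List ℕ) : List Atom := (A.map SunderTo).flatten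

/-- `S_{→ j} = S_{([1:n] ∖ {j}) → j}` (here `n = d+1`). -/
def StoFull (d j : ℕ) : List Atom := Sto ((icc 1 (d + 1)).filter (fun i => i ≠ j)) j

/-- `(S_{→ j} : j ∈ A)`. -/
def StoFullL (d : ℕ) (A : List ℕ) : List Atom := (A.map (StoFull d)).flatten

/-- `U^{(t,s)} = (W_{[1:t]}, S̄_{→[t+1:s]})`. -/
def U (d t s : ℕ) : List Atom := Ws (icc 1 t) ++ SbarToL d (icc (t + 1) s)

/-- Node regeneration: each `W j` is a deterministic function of `S_{→ j}`. -/
def Code.NodeRegen (C : Code Ω V d) : Prop :=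
  ∀ j ∈ Finset.Icc 1 (d + 1), IsFuncOf (C.W j) (C.rv (StoFull d j))

/-- Message recovery for parameter `ℓ`: `M j` is constant for `j ∈ [1:ℓ]`, and for every
`A ⊆ [1:n]` with `|A| ∈ [ℓ+1:d]`, `M_{|A|}` is a deterministic function of `W_A`. -/
def Code.MsgRecovery (C : Code Ω V d) (ℓ : ℕ) : Prop :=
  (∀ j ∈ Finset.Icc 1 ℓ, ∃ c : V, ∀ ω, C.M j ω = c) ∧
  ∀ A : Finset ℕ, A ⊆ Finset.Icc 1 (d + 1) → A.card ∈ Finset.Icc (ℓ + 1) d →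
    IsFuncOf (C.M A.card) (C.rv (Ws (A.sort (· ≤ ·))))

/-- Repair secrecy for parameters `ℓ₁, ℓ₂`: for all disjoint `E₁, E₂ ⊆ [1:n]` with
`|E₁| = ℓ₁`, `|E₂| = ℓ₂`, the messages `M_{ℓ+1}, …, M_d` are independent of
`((W_i : i ∈ E₁), (S_{→j} : j ∈ E₂))`, where `ℓ = ℓ₁ + ℓ₂`. -/
def Code.RepairSecrecy (C : Code Ω V d) (ℓ₁ ℓ₂ : ℕ) : Prop :=
  ∀ E₁ E₂ : Finset ℕ, E₁ ⊆ Finset.Icc 1 (d + 1) → E₂ ⊆ Finset.Icc 1 (d + 1) →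
    Disjoint E₁ E₂ → E₁.card = ℓ₁ → E₂.card = ℓ₂ →
    C.MI (MsL (icc (ℓ₁ + ℓ₂ + 1) d))
      (Ws (E₁.sort (· ≤ ·)) ++ StoFullL d (E₂.sort (· ≤ ·))) = 0

/-- `T_{d,k,ℓ} = Σ_{t=ℓ+1}^{k} (d+1−t)`, as a real number. -/
def T (d k ℓ : ℕ) : ℝ := ∑ t ∈ Finset.Icc (ℓ + 1) k, ((d : ℝ) + 1 - (t : ℝ))


section Entropy

variable {α β γ δ : Type*} {p : Ω → ℝ}

lemma pm_eq_sum_ite (p : Ω → ℝ) (X : Ω → α) (x : α) :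
    pm p X x = ∑ ω, if X ω = x then p ω else 0 := by
  rw [pm, Finset.sum_filter]

lemma pm_nonneg (hp : ∀ ω, 0 ≤ p ω) (X : Ω → α) (x : α) : 0 ≤ pm p X x :=
  Finset.sum_nonneg fun ω _ => hp ω

lemma le_pm_self (hp : ∀ ω, 0 ≤ p ω) (X : Ω → α) (ω : Ω) : p ω ≤ pm p X (X ω) :=
  Finset.single_le_sum (fun ω' _ => hp ω') (Finset.mem_filter.2 ⟨Finset.mem_univ ω, rfl⟩)

/-- Entropy is monotone: if `Y` determines `X`, then `H(X) ≤ H(Y)`. -/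
lemma H_mono (hp : ∀ ω, 0 ≤ p ω) (X : Ω → α) (Y : Ω → β)
    (h : ∀ ω ω', Y ω = Y ω' → X ω = X ω') : H p X ≤ H p Y := by
  unfold H
  refine neg_le_neg (Finset.sum_le_sum fun ω _ => ?_)
  rcases (hp ω).eq_or_lt with h0 | h0
  · simp [← h0]
  · refine mul_le_mul_of_nonneg_left ?_ (hp ω)
    refine Real.log_le_log (h0.trans_le (le_pm_self hp Y ω)) ?_
    refine Finset.sum_le_sum_of_subset_of_nonneg (fun ω' hω' => ?_) fun ω' _ _ => hp ω'
    simp only [Finset.mem_filter, Finset.mem_univ, true_and] at hω' ⊢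
    exact h _ _ hω'

lemma sum_mul_pm_mul_pm_div_le (hp : ∀ ω, 0 ≤ p ω)
    (T : Ω → α) (Z : Ω → β) (A : Ω → γ) (B : Ω → δ)
    (hT : ∀ ω ω', A ω = A ω' → B ω = B ω' → T ω = T ω')
    (hAZ : ∀ ω ω', A ω = A ω' → Z ω = Z ω') (hBZ : ∀ ω ω', B ω = B ω' → Z ω = Z ω') :
    ∑ ω, p ω * (pm p A (A ω) * pm p B (B ω) / (pm p T (T ω) * pm p Z (Z ω))) ≤ ∑ ω, p ω := by
  have inner (ω₁ ω₂ : Ω) :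
      ∑ ω, (if A ω₁ = A ω ∧ B ω₂ = B ω then p ω / (pm p T (T ω) * pm p Z (Z ω)) else 0)
        ≤ if Z ω₂ = Z ω₁ then (pm p Z (Z ω₁))⁻¹ else 0 := by
    by_cases hex : ∃ ω₀, A ω₁ = A ω₀ ∧ B ω₂ = B ω₀
    · obtain ⟨ω₀, hA, hB⟩ := hex
      have hZ₁ := hAZ _ _ hA
      have hZ₂ := hBZ _ _ hB
      rw [if_pos (hZ₂.trans hZ₁.symm), hZ₁]
      calc _ ≤ ∑ ω, (if T ω = T ω₀ then p ω else 0) *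
            (pm p T (T ω₀) * pm p Z (Z ω₀))⁻¹ := by
            refine Finset.sum_le_sum fun ω _ => ?_
            split_ifs with h1 h2 h2
            · rw [h2, ← hAZ _ _ h1.1, hZ₁, div_eq_mul_inv]
            · exact absurd (hT _ _ (h1.1.symm.trans hA) (h1.2.symm.trans hB)) h2
            · exact mul_nonneg (hp ω)
                (inv_nonneg.2 (mul_nonneg (pm_nonneg hp _ _) (pm_nonneg hp _ _)))
            · simp
        _ = pm p T (T ω₀) * (pm p T (T ω₀))⁻¹ * (pm p Z (Z ω₀))⁻¹ := by
            rw [← Finset.sum_mul, ← pm_eq_sum_ite, mul_inv, mul_assoc]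
        _ ≤ 1 * (pm p Z (Z ω₀))⁻¹ :=
            mul_le_mul_of_nonneg_right mul_inv_le_one (inv_nonneg.2 (pm_nonneg hp _ _))
        _ = _ := one_mul _
    · have hex' : ∀ ω, ¬ (A ω₁ = A ω ∧ B ω₂ = B ω) := fun ω h => hex ⟨ω, h⟩
      simp only [hex', if_false, Finset.sum_const_zero]
      split_ifs
      · exact inv_nonneg.2 (pm_nonneg hp _ _)
      · exact le_rfl
  calc _ = ∑ ω₁, ∑ ω₂, p ω₁ * p ω₂ * ∑ ω, (if A ω₁ = A ω ∧ B ω₂ = B ω then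
        p ω / (pm p T (T ω) * pm p Z (Z ω)) else 0) := by
        simp only [Finset.mul_sum]
        rw [Finset.sum_congr rfl fun ω₁ _ => Finset.sum_comm, Finset.sum_comm]
        refine Finset.sum_congr rfl fun ω _ => ?_
        rw [pm_eq_sum_ite p A, pm_eq_sum_ite p B, Finset.sum_mul_sum, Finset.sum_div,
          Finset.mul_sum]
        refine Finset.sum_congr rfl fun ω₁ _ => ?_
        rw [Finset.sum_div, Finset.mul_sum]
        refine Finset.sum_congr rfl fun ω₂ _ => ?_
        by_cases h1 : A ω₁ = A ω <;> by_cases h2 : B ω₂ = B ω <;> simp [h1, h2]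
        ring
    _ ≤ ∑ ω₁, ∑ ω₂, p ω₁ * p ω₂ * (if Z ω₂ = Z ω₁ then (pm p Z (Z ω₁))⁻¹ else 0) :=
        Finset.sum_le_sum fun ω₁ _ => Finset.sum_le_sum fun ω₂ _ =>
          mul_le_mul_of_nonneg_left (inner ω₁ ω₂) (mul_nonneg (hp _) (hp _))
    _ = ∑ ω₁, p ω₁ * (pm p Z (Z ω₁) * (pm p Z (Z ω₁))⁻¹) := by
        refine Finset.sum_congr rfl fun ω₁ _ => ?_
        conv_rhs => rw [pm_eq_sum_ite p Z, Finset.sum_mul, Finset.mul_sum]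
        refine Finset.sum_congr rfl fun ω₂ _ => ?_
        split_ifs
        · rw [← pm_eq_sum_ite, mul_assoc]
        · simp
    _ ≤ ∑ ω, p ω := Finset.sum_le_sum fun ω _ => mul_le_of_le_one_right (hp ω) mul_inv_le_one

/-- Submodularity of entropy: if `A` and `B` both determine `Z` and jointly determine `T`, then
`H(T) + H(Z) ≤ H(A) + H(B)`. -/
lemma H_submodular (hp : ∀ ω, 0 ≤ p ω) (T : Ω → α) (Z : Ω → β) (A : Ω → γ) (B : Ω → δ)
    (hT : ∀ ω ω', A ω = A ω' → B ω = B ω' → T ω = T ω')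
    (hAZ : ∀ ω ω', A ω = A ω' → Z ω = Z ω') (hBZ : ∀ ω ω', B ω = B ω' → Z ω = Z ω') :
    H p T + H p Z ≤ H p A + H p B := by
  have key : ∑ ω, p ω * (Real.log (pm p A (A ω)) + Real.log (pm p B (B ω))
      - Real.log (pm p T (T ω)) - Real.log (pm p Z (Z ω))) ≤
      ∑ ω, (p ω * (pm p A (A ω) * pm p B (B ω) / (pm p T (T ω) * pm p Z (Z ω))) - p ω) := by
    refine Finset.sum_le_sum fun ω _ => ?_
    rcases (hp ω).eq_or_lt with h0 | h0
    · simp [← h0]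
    · have hA := h0.trans_le (le_pm_self hp A ω)
      have hB := h0.trans_le (le_pm_self hp B ω)
      have hT' := h0.trans_le (le_pm_self hp T ω)
      have hZ := h0.trans_le (le_pm_self hp Z ω)
      have hlog := Real.log_le_sub_one_of_pos (div_pos (mul_pos hA hB) (mul_pos hT' hZ))
      rw [Real.log_div (by positivity) (by positivity), Real.log_mul hA.ne' hB.ne',
        Real.log_mul hT'.ne' hZ.ne'] at hlog
      nlinarith [mul_le_mul_of_nonneg_left hlog h0.le]
  have hsum := sum_mul_pm_mul_pm_div_le hp T Z A B hT hAZ hBZ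
  simp only [Finset.sum_sub_distrib, mul_sub, mul_add, Finset.sum_add_distrib] at key
  unfold H
  linarith

end Entropy

namespace Code

variable (C : Code Ω V d)

/-- The atom `a` is determined by the joint value of the atoms in `L`. -/
def Determines (L : List Atom) (a : Atom) : Prop :=
  ∀ ω ω', C.rv L ω = C.rv L ω' → C.atomRV a ω = C.atomRV a ω'

variable {C}

lemma rv_eq_iff {L : List Atom} {ω ω' : Ω} :
    C.rv L ω = C.rv L ω' ↔ ∀ a ∈ L, C.atomRV a ω = C.atomRV a ω' :=
  List.map_inj_left

lemma determines_of_mem {L : List Atom} {a : Atom} (h : a ∈ L) : C.Determines L a :=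
  fun _ _ he => rv_eq_iff.1 he a h

lemma Determines.of_isFuncOf {L L' : List Atom} {a : Atom}
    (h : IsFuncOf (C.atomRV a) (C.rv L')) (hL : ∀ b ∈ L', C.Determines L b) :
    C.Determines L a := by
  obtain ⟨f, hf⟩ := h
  intro ω ω' he
  rw [hf, hf, rv_eq_iff.2 fun b hb => hL b hb ω ω' he]

lemma Determines.repair {L : List Atom} {i j : ℕ} (h : C.Determines L (.W i))
    (hi : i ∈ Finset.Icc 1 (d + 1)) (hj : j ∈ Finset.Icc 1 (d + 1)) (hij : i ≠ j) :
    C.Determines L (.S i j) := by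
  obtain ⟨f, hf⟩ := C.S_func i hi j hj hij
  intro ω ω' he
  change C.S i j ω = C.S i j ω'
  rw [hf, hf]
  exact congrArg f (h ω ω' he)

lemma HL_congr {L L' : List Atom} (h : ∀ a, a ∈ L ↔ a ∈ L') : C.HL L = C.HL L' :=
  le_antisymm
    (H_mono C.p_nonneg _ _ fun _ _ he => rv_eq_iff.2 fun a ha => rv_eq_iff.1 he a ((h a).1 ha))
    (H_mono C.p_nonneg _ _ fun _ _ he => rv_eq_iff.2 fun a ha => rv_eq_iff.1 he a ((h a).2 ha))

/-- Conditioning on more reduces entropy: `H(X | A) ≤ H(X | B)` when `A` determines `B`. -/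
lemma CH_le_of_determines {A B : List Atom} (X : List Atom) (h : ∀ b ∈ B, C.Determines A b) :
    C.HL (A ++ X) - C.HL A ≤ C.HL (B ++ X) - C.HL B := by
  have := H_submodular C.p_nonneg (C.rv (A ++ X)) (C.rv B) (C.rv A) (C.rv (B ++ X))
    (fun ω ω' hA hB => by
      rw [rv_eq_iff] at *
      intro a ha
      rcases List.mem_append.1 ha with ha | ha
      · exact hA a ha
      · exact hB a (List.mem_append_right _ ha))
    (fun ω ω' hA => rv_eq_iff.2 fun b hb => h b hb ω ω' hA)
    (fun ω ω' hB => rv_eq_iff.2 fun b hb => rv_eq_iff.1 hB b (List.mem_append_left _ hb))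
  unfold HL
  linarith

lemma Symmetrical.HL_eq (hsym : C.Symmetrical) {L L' : List Atom} (π : Equiv.Perm ℕ)
    (hπ : ∀ i ∈ Finset.Icc 1 (d + 1), π i ∈ Finset.Icc 1 (d + 1))
    (h : ∀ a ∈ L, Atom.perm π a ∈ L') (h' : ∀ a ∈ L', Atom.perm π.symm a ∈ L) :
    C.HL L = C.HL L' := by
  rw [← hsym π hπ L]
  refine HL_congr fun a => ⟨fun ha => ?_, fun ha => List.mem_map.2 ⟨_, h' a ha, ?_⟩⟩
  · obtain ⟨b, hb, rfl⟩ := List.mem_map.1 ha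
    exact h b hb
  · cases a <;> simp [Atom.perm]

end Code

lemma mem_icc {a b x : ℕ} : x ∈ icc a b ↔ a ≤ x ∧ x ≤ b := by
  simp only [icc, List.mem_range'_1]
  omega

lemma mem_Ws {A : List ℕ} {a : Atom} : a ∈ Ws A ↔ ∃ i ∈ A, .W i = a := List.mem_map

lemma mem_Sto {B : List ℕ} {j : ℕ} {a : Atom} : a ∈ Sto B j ↔ ∃ i ∈ B, .S i j = a :=
  List.mem_map

lemma mem_Sfrom {i : ℕ} {B : List ℕ} {a : Atom} : a ∈ Sfrom i B ↔ ∃ j ∈ B, .S i j = a :=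
  List.mem_map

lemma mem_SbarToL {A : List ℕ} {a : Atom} :
    a ∈ SbarToL d A ↔ ∃ j ∈ A, ∃ i, (j + 1 ≤ i ∧ i ≤ d + 1) ∧ .S i j = a := by
  simp [SbarToL, SbarTo, mem_Sto, mem_icc]

/-- By node regeneration, `U^{(t,s)}` determines `W_{[1:s]}`. -/
lemma Code.NodeRegen.determines_W {C : Code Ω V d} (hregen : C.NodeRegen) {t s : ℕ}
    (hs : s ≤ d + 1) (k : ℕ) (hk : 1 ≤ k) (hks : k ≤ s) :
    C.Determines (U d t s) (.W k) := by
  induction k using Nat.strong_induction_on with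
  | _ k ih =>
    by_cases hkt : k ≤ t
    · exact determines_of_mem (List.mem_append_left _ (mem_Ws.2 ⟨k, mem_icc.2 ⟨hk, hkt⟩, rfl⟩))
    · refine Determines.of_isFuncOf (hregen k (Finset.mem_Icc.2 ⟨hk, hks.trans hs⟩)) ?_
      intro b hb
      obtain ⟨i, hi, rfl⟩ := mem_Sto.1 hb
      simp only [List.mem_filter, mem_icc, decide_eq_true_eq] at hi
      rcases lt_or_gt_of_ne hi.2 with hik | hik
      · exact (ih i hik hi.1.1 (by omega)).repair (Finset.mem_Icc.2 hi.1)
          (Finset.mem_Icc.2 ⟨hk, by omega⟩) hi.2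
      · refine determines_of_mem (List.mem_append_right _ (mem_SbarToL.2 ⟨k, ?_, i, ?_, rfl⟩))
        · rw [mem_icc]; omega
        · omega

/-- The tuple `(W_{[1:t]}, S_{t+1→[1:t]}, S_{[t+2:t+k+1]→t+1})`. -/
def incomingTuple (t k : ℕ) : List Atom :=
  Ws (icc 1 t) ++ Sfrom (t + 1) (icc 1 t) ++ Sto (icc (t + 2) (t + k + 1)) (t + 1)

lemma Code.Symmetrical.incomingTuple_concave {C : Code Ω V d} (hsym : C.Symmetrical) {t k : ℕ}
    (hk : t + k + 2 ≤ d) :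
    C.HL (incomingTuple t (k + 2)) - C.HL (incomingTuple t (k + 1)) ≤
      C.HL (incomingTuple t (k + 1)) - C.HL (incomingTuple t k) := by
  have hcond := CH_le_of_determines (C := C) (A := incomingTuple t (k + 1)) (B := incomingTuple t k)
    [.S (t + k + 3) (t + 1)] fun b hb => determines_of_mem (by
      simp only [incomingTuple, List.mem_append, mem_Sto, mem_icc] at hb ⊢
      refine hb.imp_right ?_
      rintro ⟨i, hi, rfl⟩
      exact ⟨i, by omega, rfl⟩)
  have hadd : C.HL (incomingTuple t (k + 2)) =
      C.HL (incomingTuple t (k + 1) ++ [.S (t + k + 3) (t + 1)]) := HL_congr fun a => by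
    cases a <;> simp [incomingTuple, mem_Ws, mem_Sto, mem_Sfrom, mem_icc]
    omega
  have hswap : C.HL (incomingTuple t k ++ [.S (t + k + 3) (t + 1)]) =
      C.HL (incomingTuple t (k + 1)) := by
    refine hsym.HL_eq (Equiv.swap (t + k + 2) (t + k + 3)) ?_ ?_ ?_
    · intro i hi
      rw [Finset.mem_Icc] at hi ⊢
      rw [Equiv.swap_apply_def]
      split_ifs <;> omega
    · intro a
      cases a <;> simp [incomingTuple, mem_Ws, mem_Sto, mem_Sfrom, mem_icc, Atom.perm,
        Equiv.swap_apply_def] <;> grind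
    · intro a
      cases a <;> simp [incomingTuple, mem_Ws, mem_Sto, mem_Sfrom, mem_icc, Atom.perm,
        Equiv.swap_apply_def] <;> grind
  linarith

/-- For `f` concave on `[0:a]`, the average slope on `[m:a]` is at most that on `[0:a]`. -/
lemma mul_sub_le_of_concave {f : ℕ → ℝ} {a m : ℕ} (hm : m < a)
    (hf : ∀ k, k + 2 ≤ a → f (k + 2) - f (k + 1) ≤ f (k + 1) - f k) :
    (a : ℝ) * (f a - f m) ≤ ((a : ℝ) - m) * (f a - f 0) := by
  have hslope : ∀ j, m + j < a → f (m + j + 1) - f (m + j) ≤ f (m + 1) - f m := by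
    intro j
    induction j with
    | zero => intro _; simp
    | succ j ih => intro hj; exact (hf (m + j) (by omega)).trans (ih (by omega))
  have hright : ∀ j, m + j ≤ a → f (m + j) - f m ≤ j * (f (m + 1) - f m) := by
    intro j
    induction j with
    | zero => intro _; simp
    | succ j ih =>
      intro hj
      have h1 := ih (by omega)
      have h2 := hslope j (by omega)
      push_cast
      rw [← add_assoc]
      linarith
  have hleft : ∀ k, k < a → k * (f (k + 1) - f k) ≤ f k - f 0 := by
    intro k
    induction k with
    | zero => intro _; simp
    | succ k ih =>
      intro hk
      have h1 := ih (by omega)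
      have h2 := mul_le_mul_of_nonneg_left (hf k (by omega))
        (by positivity : (0 : ℝ) ≤ (k : ℝ) + 1)
      push_cast
      linarith
  obtain ⟨b, rfl⟩ := Nat.exists_eq_add_of_lt hm
  have h1 := hright (b + 1) (by omega)
  have h2 := hleft m hm
  have h3 := mul_le_mul_of_nonneg_left h1 (Nat.cast_nonneg (α := ℝ) m)
  have h4 := mul_le_mul_of_nonneg_left h2 (Nat.cast_nonneg (α := ℝ) (b + 1))
  rw [← add_assoc] at h3
  push_cast at h3 h4 ⊢
  linarith

/-- The permutation moving `[t+1:2t]` onto `[1:t]`, `s+1` to `t+1`, and `[1:t] ∪ [2t+1:s]` onto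
`[t+2:s+1]`, fixing everything else. -/
def blockPerm (t s : ℕ) (h : 2 * t ≤ s) : Equiv.Perm ℕ where
  toFun i :=
    if 1 ≤ i ∧ i ≤ t then i + t + 1 else if t + 1 ≤ i ∧ i ≤ 2 * t then i - t
    else if 2 * t + 1 ≤ i ∧ i ≤ s then i + 1 else if i = s + 1 then t + 1 else i
  invFun i :=
    if 1 ≤ i ∧ i ≤ t then i + t else if i = t + 1 then s + 1
    else if t + 2 ≤ i ∧ i ≤ 2 * t + 1 then i - t - 1
    else if 2 * t + 2 ≤ i ∧ i ≤ s + 1 then i - 1 else i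
  left_inv i := by grind
  right_inv i := by grind

/-- The tuple `(W_{[t+1:2t]}, S_{s+1→[t+1:2t]}, S_{[1:t]∪[2t+1:s]→s+1})`. -/
def shiftedTuple (t s : ℕ) : List Atom :=
  Ws (icc (t + 1) (2 * t)) ++ Sfrom (s + 1) (icc (t + 1) (2 * t)) ++
    Sto (icc 1 t ++ icc (2 * t + 1) s) (s + 1)

lemma Code.Symmetrical.HL_shiftedTuple {C : Code Ω V d} (hsym : C.Symmetrical) {t s : ℕ}
    (hts : 2 * t ≤ s) (hs : s ≤ d) :
    C.HL (shiftedTuple t s) = C.HL (incomingTuple t (s - t)) := by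
  refine hsym.HL_eq (blockPerm t s hts) ?_ ?_ ?_
  · intro i hi
    rw [Finset.mem_Icc] at hi ⊢
    simp only [blockPerm, Equiv.coe_fn_mk]
    grind
  · intro a
    cases a <;> simp [incomingTuple, shiftedTuple, mem_Ws, mem_Sto, mem_Sfrom, mem_icc, Atom.perm,
      blockPerm] <;> grind
  · intro a
    cases a <;> simp [incomingTuple, shiftedTuple, mem_Ws, mem_Sto, mem_Sfrom, mem_icc, Atom.perm,
      blockPerm] <;> grind

lemma Code.Symmetrical.HL_shiftedTuple_append {C : Code Ω V d} (hsym : C.Symmetrical) {t s : ℕ}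
    (hts : 2 * t ≤ s) (hs : s ≤ d) :
    C.HL (shiftedTuple t s ++ SbarTo d (s + 1)) = C.HL (incomingTuple t (d - t)) := by
  refine hsym.HL_eq (blockPerm t s hts) ?_ ?_ ?_
  · intro i hi
    rw [Finset.mem_Icc] at hi ⊢
    simp only [blockPerm, Equiv.coe_fn_mk]
    grind
  · intro a
    cases a <;> simp [incomingTuple, shiftedTuple, SbarTo, mem_Ws, mem_Sto, mem_Sfrom, mem_icc,
      Atom.perm, blockPerm] <;> grind
  · intro a
    cases a <;> simp [incomingTuple, shiftedTuple, SbarTo, mem_Ws, mem_Sto, mem_Sfrom, mem_icc,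
      Atom.perm, blockPerm] <;> grind

/-- `U^{(t,s)}` determines `shiftedTuple t s`. -/
lemma Code.NodeRegen.determines_shiftedTuple {C : Code Ω V d} (hregen : C.NodeRegen) {t s : ℕ}
    (hts : 2 * t ≤ s) (hs : s ≤ d) : ∀ b ∈ shiftedTuple t s, C.Determines (U d t s) b := by
  intro b hb
  simp only [shiftedTuple, List.mem_append, mem_Ws, mem_Sto, mem_Sfrom, mem_icc] at hb
  rcases hb with (⟨i, hi, rfl⟩ | ⟨j, hj, rfl⟩) | ⟨i, hi, rfl⟩
  · exact hregen.determines_W (by omega) i (by omega) (by omega)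
  · refine determines_of_mem (List.mem_append_right _ (mem_SbarToL.2 ⟨j, ?_, s + 1, ?_, rfl⟩))
    · rw [mem_icc]; omega
    · omega
  · exact (hregen.determines_W (by omega) i (by omega) (by omega)).repair
      (Finset.mem_Icc.2 (by omega)) (Finset.mem_Icc.2 (by omega)) (by omega)

theorem statement9 {Ω V : Type} [Fintype Ω] {d : ℕ} (hd : 2 ≤ d)
    (C : Code Ω V d) (hsym : C.Symmetrical) (hregen : C.NodeRegen)
    {ℓ ℓ₁ : ℕ} (hℓ : ℓ ∈ Finset.Icc 1 (d - 1)) (hℓ₁ : ℓ₁ ∈ Finset.Icc 0 (ℓ / 2)) :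
    ((d : ℝ) - (ℓ₁ : ℝ)) / ((d : ℝ) - (ℓ : ℝ)) * C.HL (U d ℓ₁ ℓ)
        + C.HL (U d ℓ₁ (ℓ₁ + 1) ++ Sfrom (ℓ₁ + 1) (icc 1 ℓ₁))
      ≥ ((d : ℝ) - (ℓ₁ : ℝ)) / ((d : ℝ) - (ℓ : ℝ)) * C.HL (U d ℓ₁ (ℓ + 1))
        + C.HL (U d ℓ₁ ℓ₁ ++ Sfrom (ℓ₁ + 1) (icc 1 ℓ₁)) := by
  rw [Finset.mem_Icc] at hℓ hℓ₁
  have hts : 2 * ℓ₁ ≤ ℓ := by omega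
  have hcond := Code.CH_le_of_determines (SbarTo d (ℓ + 1))
    (hregen.determines_shiftedTuple hts (by omega))
  rw [hsym.HL_shiftedTuple hts (by omega), hsym.HL_shiftedTuple_append hts (by omega)] at hcond
  have hU : C.HL (U d ℓ₁ (ℓ + 1)) = C.HL (U d ℓ₁ ℓ ++ SbarTo d (ℓ + 1)) :=
    Code.HL_congr fun a => by
      cases a <;> simp [U, SbarTo, mem_Ws, mem_SbarToL, mem_Sto, mem_icc]
      grind
  have hlast : C.HL (U d ℓ₁ (ℓ₁ + 1) ++ Sfrom (ℓ₁ + 1) (icc 1 ℓ₁)) =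
      C.HL (incomingTuple ℓ₁ (d - ℓ₁)) := Code.HL_congr fun a => by
    cases a <;> simp [U, incomingTuple, mem_Ws, mem_SbarToL, mem_Sto, mem_Sfrom, mem_icc]
    grind
  have hfirst : C.HL (U d ℓ₁ ℓ₁ ++ Sfrom (ℓ₁ + 1) (icc 1 ℓ₁)) =
      C.HL (incomingTuple ℓ₁ 0) := Code.HL_congr fun a => by
    cases a <;> simp [U, incomingTuple, mem_Ws, mem_SbarToL, mem_Sto, mem_Sfrom, mem_icc]
    grind
  have hconc := mul_sub_le_of_concave (f := fun k => C.HL (incomingTuple ℓ₁ k)) (a := d - ℓ₁)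
    (m := ℓ - ℓ₁) (by omega) fun k hk => hsym.incomingTuple_concave (by omega)
  rw [Nat.cast_sub (by omega), Nat.cast_sub (by omega)] at hconc
  have hb : (0 : ℝ) < (d : ℝ) - ℓ := sub_pos.2 (by exact_mod_cast (by omega : ℓ < d))
  have ha : (0 : ℝ) ≤ (d : ℝ) - ℓ₁ := sub_nonneg.2 (by exact_mod_cast (by omega : ℓ₁ ≤ d))
  rw [sub_sub_sub_cancel_right] at hconc
  have hratio := mul_le_mul_of_nonneg_left hcond (div_nonneg ha hb.le)
  have hslope : ((d : ℝ) - ℓ₁) / ((d : ℝ) - ℓ) *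
      (C.HL (incomingTuple ℓ₁ (d - ℓ₁)) - C.HL (incomingTuple ℓ₁ (ℓ - ℓ₁))) ≤
      C.HL (incomingTuple ℓ₁ (d - ℓ₁)) - C.HL (incomingTuple ℓ₁ 0) := by
    rw [div_mul_eq_mul_div, div_le_iff₀ hb, mul_comm _ ((d : ℝ) - ℓ)]
    exact hconc
  rw [hU, hlast, hfirst]
  linarith

end

end MDCSR
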